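/- The GL_5-invariants of QP_5((3,2,2,1)) vanish: if f is an F_2-linear combination of monomials of degree 23 whose weight vectors are ≤ (3,2,2,1,0,...) in left lexicographic order, and for every g in GL_5(F_2) the polynomial g·f − f is the sum of a hit polynomial and an element of P_5^−((3,2,2,1)), then f itself is the sum of a hit polynomial and an element of P_5^−((3,2,2,1)). -/

import Mathlib

open MvPolynomial

noncomputable section

/-- The polynomial algebra `P_5 = F_2[x_1,...,x_5]`. -/
abbrev P5 : Type := MvPolynomial (Fin 5) (ZMod 2)

/-- The total Steenrod square: the `F_2`-algebra endomorphism with `Sq (x_i) = x_i + x_i ^ 2`. -/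
def Sq : P5 →ₐ[ZMod 2] P5 := aeval fun i => X i + X i ^ 2

/-- `f` (homogeneous of degree `n`) is hit if it is the degree-`n` homogeneous component of
`Sq g` for some `g` all of whose homogeneous components have degree `< n`. -/
def IsHit (n : ℕ) (f : P5) : Prop :=
  ∃ g : P5, (∀ m, n ≤ m → homogeneousComponent m g = 0) ∧
    f = homogeneousComponent n (Sq g)

/-- The subspace of hit polynomials of degree `n`. -/
def hitSpan (n : ℕ) : Submodule (ZMod 2) P5 :=
  Submodule.span (ZMod 2) {f : P5 | IsHit n f}

/-- The action of `GL_5(F_2)` on `P_5` by linear substitution of the variables. -/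
def actGL (g : Matrix.GeneralLinearGroup (Fin 5) (ZMod 2)) : P5 →ₐ[ZMod 2] P5 :=
  aeval fun i => ∑ j, ((g : Matrix (Fin 5) (Fin 5) (ZMod 2)) i j) • X j

/-- `wt d i` is the `(i+1)`-st entry `ω_{i+1}` of the weight vector of the monomial with
exponent vector `d`, i.e. the number of `j` such that bit `i` of `d j` is `1`. -/
def wt (d : Fin 5 →₀ ℕ) (i : ℕ) : ℕ :=
  (Finset.univ.filter fun j : Fin 5 => Nat.testBit (d j) i).card

/-- The weight vector of the exponent vector `d` equals the (finitely supported) list `w`. -/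
def hasWt (d : Fin 5 →₀ ℕ) (w : List ℕ) : Prop :=
  ∀ i, wt d i = w.getD i 0

/-- The weight vector of `d` is strictly smaller than `w` in left lexicographic order. -/
def wtLt (d : Fin 5 →₀ ℕ) (w : List ℕ) : Prop :=
  ∃ i, (∀ j, j < i → wt d j = w.getD j 0) ∧ wt d i < w.getD i 0

/-- `P_5^-(ω)`: the span of degree-`n` monomials whose weight vector is `< w`. -/
def PMinus (n : ℕ) (w : List ℕ) : Submodule (ZMod 2) P5 :=
  Submodule.span (ZMod 2)
    {x : P5 | ∃ d : Fin 5 →₀ ℕ, x = monomial d 1 ∧ (∑ j, d j) = n ∧ wtLt d w}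

/-- `P_5(ω)`: the span of degree-`n` monomials whose weight vector is `≤ w`. -/
def PLe (n : ℕ) (w : List ℕ) : Submodule (ZMod 2) P5 :=
  Submodule.span (ZMod 2)
    {x : P5 | ∃ d : Fin 5 →₀ ℕ, x = monomial d 1 ∧ (∑ j, d j) = n ∧ (wtLt d w ∨ hasWt d w)}

/-- The monomial `x_1^a x_2^b x_3^c x_4^d x_5^e`. -/
def mon (a b c d e : ℕ) : P5 :=
  X 0 ^ a * X 1 ^ b * X 2 ^ c * X 3 ^ d * X 4 ^ e

/-- The field with 32 elements; the bits of an element are its coordinates with respect to the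
powers of a root of `t ^ 5 + t ^ 2 + 1`. -/
def F32 : Type := Fin 32

namespace F32

instance : DecidableEq F32 := inferInstanceAs (DecidableEq (Fin 32))
instance : Fintype F32 := inferInstanceAs (Fintype (Fin 32))

/-- The element with bits given by `n`. -/
def ofNat (n : ℕ) : F32 := (⟨n % 32, Nat.mod_lt _ (by norm_num)⟩ : Fin 32)

/-- The bits of an element. -/
def toNat (a : F32) : ℕ := Fin.val (n := 32) a

theorem toNat_lt (a : F32) : a.toNat < 32 := Fin.isLt (n := 32) a

/-- Multiplication by the root `2` of `t ^ 5 + t ^ 2 + 1`. -/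
def dbl (n : ℕ) : ℕ := (2 * n) ^^^ (n / 16 * 37)

/-- Multiplication on bits. -/
def mulNat (a b : ℕ) : ℕ :=
  ((b % 2 * a) ^^^ (b / 2 % 2 * dbl a) ^^^ (b / 4 % 2 * dbl (dbl a)) ^^^
    (b / 8 % 2 * dbl (dbl (dbl a))) ^^^ (b / 16 % 2 * dbl (dbl (dbl (dbl a))))) % 32

instance : Add F32 := ⟨fun a b => ofNat (a.toNat ^^^ b.toNat)⟩
instance : Mul F32 := ⟨fun a b => ofNat (mulNat a.toNat b.toNat)⟩
instance : Zero F32 := ⟨ofNat 0⟩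
instance : One F32 := ⟨ofNat 1⟩
instance : Neg F32 := ⟨fun a => a⟩

theorem toNat_ofNat_of_lt {n : ℕ} (h : n < 32) : (ofNat n).toNat = n := Nat.mod_eq_of_lt h

theorem toNat_add (a b : F32) : (a + b).toNat = a.toNat ^^^ b.toNat :=
  toNat_ofNat_of_lt (Nat.xor_lt_two_pow (n := 5) a.toNat_lt b.toNat_lt)

theorem toNat_mul (a b : F32) : (a * b).toNat = mulNat a.toNat b.toNat :=
  toNat_ofNat_of_lt (Nat.mod_lt _ (by norm_num))

theorem toNat_injective : Function.Injective toNat := Fin.val_injective (n := 32)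

theorem mulNat_assoc : ((List.range 32).all fun a => (List.range 32).all fun b =>
    (List.range 32).all fun c => mulNat (mulNat a b) c == mulNat a (mulNat b c)) = true := by
  decide +kernel

theorem mulNat_xor : ((List.range 32).all fun a => (List.range 32).all fun b =>
    (List.range 32).all fun c => mulNat a (b ^^^ c) == (mulNat a b ^^^ mulNat a c)) = true := by
  decide +kernel

protected theorem mul_comm : ∀ a b : F32, a * b = b * a := by decide +kernel

protected theorem mul_add (a b c : F32) : a * (b + c) = a * b + a * c := by
  have h := mulNat_xor
  simp only [List.all_eq_true, List.mem_range, beq_iff_eq] at h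
  apply toNat_injective
  simpa only [toNat_add, toNat_mul] using h _ a.toNat_lt _ b.toNat_lt _ c.toNat_lt

instance : CommRing F32 where
  add_assoc a b c := toNat_injective (by simp only [toNat_add, Nat.xor_assoc])
  zero_add := by decide +kernel
  add_zero := by decide +kernel
  add_comm a b := toNat_injective (by simp only [toNat_add, Nat.xor_comm])
  neg_add_cancel := by decide +kernel
  mul_assoc a b c := by
    have h := mulNat_assoc
    simp only [List.all_eq_true, List.mem_range, beq_iff_eq] at h
    apply toNat_injective
    simpa only [toNat_mul] using h _ a.toNat_lt _ b.toNat_lt _ c.toNat_lt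
  one_mul := by decide +kernel
  mul_one := by decide +kernel
  mul_comm := F32.mul_comm
  left_distrib := F32.mul_add
  right_distrib a b c := by rw [F32.mul_comm, F32.mul_add, F32.mul_comm c, F32.mul_comm c]
  zero_mul := by decide +kernel
  mul_zero := by decide +kernel
  nsmul := nsmulRec
  zsmul := zsmulRec

instance : Nontrivial F32 := ⟨0, 1, by decide⟩

instance : CharP F32 2 :=
  CharTwo.of_one_ne_zero_of_two_eq_zero (by decide) (by decide)

instance : Algebra (ZMod 2) F32 := ZMod.algebra F32 2

/-- A root of `t ^ 5 + t ^ 2 + 1`. -/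
def ζ : F32 := ofNat 2

/-- The `ZMod 2`-linear functional reading off the constant coordinate. -/
def lam : F32 →ₗ[ZMod 2] ZMod 2 :=
  (AddMonoidHom.mk' (fun a : F32 => ((a.toNat : ℕ) : ZMod 2))
    (by decide +kernel)).toZModLinearMap 2

theorem lam_one : lam 1 = 1 := by decide +kernel

end F32

section Coefficients

variable {K : Type*} [CommRing K] [Algebra (ZMod 2) K]

/-- The space of sums of a hit polynomial of degree `23` and an element of `PMinus`. -/
def hitMinus : Submodule (ZMod 2) P5 where
  carrier := {f | ∃ h p : P5, IsHit 23 h ∧ p ∈ PMinus 23 [3, 2, 2, 1] ∧ f = h + p}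
  add_mem' := by
    rintro _ _ ⟨_, p, ⟨g, hg, rfl⟩, hp, rfl⟩ ⟨_, p', ⟨g', hg', rfl⟩, hp', rfl⟩
    refine ⟨_, p + p', ⟨g + g', fun m hm => ?_, rfl⟩, add_mem hp hp', ?_⟩
    · rw [map_add, hg m hm, hg' m hm, add_zero]
    · rw [map_add, map_add]; abel
  zero_mem' := ⟨0, 0, ⟨0, by simp, by simp⟩, zero_mem _, by simp⟩
  smul_mem' := by
    rintro c _ ⟨_, p, ⟨g, hg, rfl⟩, hp, rfl⟩
    refine ⟨_, c • p, ⟨c • g, fun m hm => ?_, rfl⟩, Submodule.smul_mem _ c hp, ?_⟩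
    · rw [map_smul, hg m hm, smul_zero]
    · rw [map_smul, map_smul, smul_add]

/-- Apply a linear functional to all coefficients of a polynomial. -/
def coeffMap (φ : K →ₗ[ZMod 2] ZMod 2) (p : MvPolynomial (Fin 5) K) : P5 :=
  ∑ m ∈ p.support, monomial m (φ (coeff m p))

theorem coeff_coeffMap (φ : K →ₗ[ZMod 2] ZMod 2) (p : MvPolynomial (Fin 5) K) (m : Fin 5 →₀ ℕ) :
    coeff m (coeffMap φ p) = φ (coeff m p) := by
  classical
  simp only [coeffMap, coeff_sum, coeff_monomial, Finset.sum_ite_eq', mem_support_iff]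
  split_ifs with h
  · rfl
  · rw [not_not.mp h, map_zero]

theorem coeffMap_add (φ : K →ₗ[ZMod 2] ZMod 2) (p q : MvPolynomial (Fin 5) K) :
    coeffMap φ (p + q) = coeffMap φ p + coeffMap φ q := by
  ext m; simp [coeff_coeffMap]

theorem coeffMap_C_mul (φ : K →ₗ[ZMod 2] ZMod 2) (c : K) (p : MvPolynomial (Fin 5) K) :
    coeffMap φ (C c * p) = coeffMap (φ ∘ₗ LinearMap.mulLeft (ZMod 2) c) p := by
  ext m; simp [coeff_coeffMap]

theorem coeffMap_map (φ : K →ₗ[ZMod 2] ZMod 2) (u : P5) :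
    coeffMap φ (map (algebraMap (ZMod 2) K) u) = φ 1 • u := by
  ext m
  rw [coeff_coeffMap, coeff_map, Algebra.algebraMap_eq_smul_one, map_smul, coeff_smul, smul_eq_mul,
    smul_eq_mul, mul_comm]

theorem coeffMap_homogeneousComponent (φ : K →ₗ[ZMod 2] ZMod 2) (n : ℕ)
    (p : MvPolynomial (Fin 5) K) :
    coeffMap φ (homogeneousComponent n p) = homogeneousComponent n (coeffMap φ p) := by
  ext m
  simp only [coeff_coeffMap, coeff_homogeneousComponent]
  split_ifs <;> simp

theorem algHom_map_of_X (A : P5 →ₐ[ZMod 2] P5)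
    (B : MvPolynomial (Fin 5) K →ₐ[K] MvPolynomial (Fin 5) K)
    (hAB : ∀ i, B (X i) = map (algebraMap (ZMod 2) K) (A (X i))) (u : P5) :
    B (map (algebraMap (ZMod 2) K) u) = map (algebraMap (ZMod 2) K) (A u) := by
  induction u using MvPolynomial.induction_on with
  | C a => simp [algHom_C, ← algebraMap_eq]
  | add p q hp hq => simp [hp, hq]
  | mul_X p i hp => simp [hp, hAB]

theorem coeffMap_algHom (φ : K →ₗ[ZMod 2] ZMod 2) (A : P5 →ₐ[ZMod 2] P5)
    (B : MvPolynomial (Fin 5) K →ₐ[K] MvPolynomial (Fin 5) K)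
    (hAB : ∀ i, B (X i) = map (algebraMap (ZMod 2) K) (A (X i))) (p : MvPolynomial (Fin 5) K) :
    coeffMap φ (B p) = A (coeffMap φ p) := by
  induction p using MvPolynomial.induction_on' with
  | monomial d c =>
    have h : (monomial d c : MvPolynomial (Fin 5) K)
        = C c * map (algebraMap (ZMod 2) K) (monomial d 1) := by
      simp [C_mul_monomial]
    rw [h, map_mul, algHom_map_of_X A B hAB, algHom_C, algebraMap_eq, coeffMap_C_mul,
      coeffMap_C_mul, coeffMap_map, coeffMap_map, map_smul]
  | add p q hp hq => rw [map_add, coeffMap_add, coeffMap_add, map_add, hp, hq]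

variable (K) in
/-- Polynomials over `K` all of whose coordinates over `F_2` lie in `hitMinus`. -/
def hitMinusExt : Submodule K (MvPolynomial (Fin 5) K) where
  carrier := {p | ∀ φ : K →ₗ[ZMod 2] ZMod 2, coeffMap φ p ∈ hitMinus}
  add_mem' hp hq φ := by rw [coeffMap_add]; exact add_mem (hp φ) (hq φ)
  zero_mem' φ := by
    have : coeffMap φ (0 : MvPolynomial (Fin 5) K) = 0 := by ext; simp [coeff_coeffMap]
    rw [this]; exact zero_mem _
  smul_mem' c p hp φ := by
    rw [← C_mul', coeffMap_C_mul]; exact hp _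

theorem map_mem_hitMinusExt {u : P5} (hu : u ∈ hitMinus) :
    map (algebraMap (ZMod 2) K) u ∈ hitMinusExt K := fun φ => by
  rw [coeffMap_map]; exact Submodule.smul_mem _ _ hu

theorem mem_hitMinus_of_map {u : P5} (φ : K →ₗ[ZMod 2] ZMod 2) (hφ : φ 1 = 1)
    (hu : map (algebraMap (ZMod 2) K) u ∈ hitMinusExt K) : u ∈ hitMinus := by
  have := hu φ
  rwa [coeffMap_map, hφ, one_smul] at this

/-- The `K`-linear total Steenrod square. -/
def SqExt (K : Type*) [CommRing K] : MvPolynomial (Fin 5) K →ₐ[K] MvPolynomial (Fin 5) K :=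
  aeval fun i => X i + X i ^ 2

theorem homogeneousComponent_SqExt_mem {p : MvPolynomial (Fin 5) K}
    (hp : ∀ m, 23 ≤ m → homogeneousComponent m p = 0) :
    homogeneousComponent 23 (SqExt K p) ∈ hitMinusExt K := fun φ => by
  have h0 : coeffMap φ (0 : MvPolynomial (Fin 5) K) = 0 := by ext; simp [coeff_coeffMap]
  rw [coeffMap_homogeneousComponent, coeffMap_algHom φ Sq (SqExt K) (by simp [Sq, SqExt])]
  refine ⟨_, 0, ⟨coeffMap φ p, fun m hm => ?_, rfl⟩, zero_mem _, (add_zero _).symm⟩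
  rw [← coeffMap_homogeneousComponent, hp m hm, h0]

/-- The action of `GL_5(F_2)` on polynomials over `K`. -/
def actExt (K : Type*) [CommRing K] [Algebra (ZMod 2) K]
    (g : Matrix.GeneralLinearGroup (Fin 5) (ZMod 2)) :
    MvPolynomial (Fin 5) K →ₐ[K] MvPolynomial (Fin 5) K :=
  aeval fun i => map (algebraMap (ZMod 2) K) (actGL g (X i))

theorem actExt_map (g : Matrix.GeneralLinearGroup (Fin 5) (ZMod 2)) (u : P5) :
    actExt K g (map (algebraMap (ZMod 2) K) u) = map (algebraMap (ZMod 2) K) (actGL g u) :=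
  algHom_map_of_X _ _ (fun i => by simp [actExt]) u

end Coefficients

section Weights

/-- Lexicographic comparison of weight vectors. -/
def wtLe (m d : Fin 5 →₀ ℕ) : Prop :=
  (∀ i, wt m i = wt d i) ∨ ∃ i, (∀ j, j < i → wt m j = wt d j) ∧ wt m i < wt d i

theorem wtLt_of_wtLe {m d : Fin 5 →₀ ℕ} {w : List ℕ} (h : wtLe m d) (hd : wtLt d w) :
    wtLt m w := by
  obtain ⟨k, hk, hk'⟩ := hd
  rcases h with h | ⟨i, hi, hi'⟩
  · exact ⟨k, fun j hj => by rw [h, hk j hj], by rwa [h]⟩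
  · rcases lt_trichotomy i k with hik | rfl | hik
    · exact ⟨i, fun j hj => by rw [hi j hj, hk j (hj.trans hik)], by rwa [← hk i hik]⟩
    · exact ⟨i, fun j hj => by rw [hi j hj, hk j hj], hi'.trans hk'⟩
    · exact ⟨k, fun j hj => by rw [hi j (hj.trans hik), hk j hj], by rwa [hi k hik]⟩

theorem wtLt_or_hasWt_of_wtLe {m d : Fin 5 →₀ ℕ} {w : List ℕ} (h : wtLe m d)
    (hd : wtLt d w ∨ hasWt d w) : wtLt m w ∨ hasWt m w := by
  rcases hd with hd | hd
  · exact .inl (wtLt_of_wtLe h hd)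
  · rcases h with h | ⟨i, hi, hi'⟩
    · exact .inr fun i => (h i).trans (hd i)
    · exact .inl ⟨i, fun j hj => by rw [hi j hj, hd j], by rwa [← hd i]⟩

variable {R : Type*} [CommRing R]

variable (R) in
/-- The span of the monomials of the same degree as `d` with weight vector at most that of `d`. -/
def wtSpan (d : Fin 5 →₀ ℕ) : Submodule R (MvPolynomial (Fin 5) R) :=
  Submodule.span R {x | ∃ m, x = monomial m 1 ∧ ∑ j, m j = ∑ j, d j ∧ wtLe m d}

theorem wt_zero_le (u m : Fin 5 →₀ ℕ) : wt (u + 2 • m) 0 ≤ ∑ j, u j := by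
  rw [wt, Finset.card_filter]
  refine Finset.sum_le_sum fun j _ => ?_
  simp only [Finsupp.add_apply, Finsupp.smul_apply, smul_eq_mul, Nat.testBit_zero,
    decide_eq_true_eq]
  split_ifs <;> omega

theorem wt_zero_eq {u : Fin 5 →₀ ℕ} (hu : ∀ j, u j ≤ 1) (m : Fin 5 →₀ ℕ) :
    wt (u + 2 • m) 0 = ∑ j, u j := by
  rw [wt, Finset.card_filter]
  refine Finset.sum_congr rfl fun j _ => ?_
  have := hu j
  simp only [Finsupp.add_apply, Finsupp.smul_apply, smul_eq_mul, Nat.testBit_zero,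
    decide_eq_true_eq]
  split_ifs <;> omega

theorem wt_succ_eq {u : Fin 5 →₀ ℕ} (hu : ∀ j, u j ≤ 1) (m : Fin 5 →₀ ℕ) (i : ℕ) :
    wt (u + 2 • m) (i + 1) = wt m i := by
  rw [wt, wt]
  congr 1
  refine Finset.filter_congr fun j _ => ?_
  have := hu j
  have h : (u + 2 • m) j / 2 = m j := by
    simp only [Finsupp.add_apply, Finsupp.smul_apply, smul_eq_mul]; omega
  rw [Nat.testBit_succ, h]

theorem le_one_of_wt_zero_eq {u m : Fin 5 →₀ ℕ} (h : wt (u + 2 • m) 0 = ∑ j, u j) (j : Fin 5) :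
    u j ≤ 1 := by
  by_contra! hj
  refine absurd h (ne_of_lt ?_)
  rw [wt, Finset.card_filter]
  refine Finset.sum_lt_sum (fun j _ => ?_) ⟨j, Finset.mem_univ _, ?_⟩
  all_goals
    simp only [Finsupp.add_apply, Finsupp.smul_apply, smul_eq_mul, Nat.testBit_zero,
      decide_eq_true_eq]
    split_ifs <;> omega

theorem wtLe_add_two_nsmul {u r m q : Fin 5 →₀ ℕ} (hr : ∀ j, r j ≤ 1)
    (hur : ∑ j, u j = ∑ j, r j) (hmq : wtLe m q) : wtLe (u + 2 • m) (r + 2 • q) := by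
  rcases (wt_zero_le u m).lt_or_eq with h | h
  · exact .inr ⟨0, fun j hj => absurd hj (by simp), by rwa [wt_zero_eq hr, ← hur]⟩
  · have hu := le_one_of_wt_zero_eq h
    have h0 : wt (u + 2 • m) 0 = wt (r + 2 • q) 0 := by rw [h, wt_zero_eq hr, hur]
    rcases hmq with hmq | ⟨i, hi, hi'⟩
    · left
      rintro (_ | i)
      · exact h0
      · rw [wt_succ_eq hu, wt_succ_eq hr, hmq]
    · refine .inr ⟨i + 1, ?_, by rwa [wt_succ_eq hu, wt_succ_eq hr]⟩
      rintro (_ | j) hj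
      · exact h0
      · rw [wt_succ_eq hu, wt_succ_eq hr, hi j (by omega)]

theorem sq_mem_span_monomial [CharP R 2] {S : Set (Fin 5 →₀ ℕ)} {p : MvPolynomial (Fin 5) R}
    (hp : p ∈ Submodule.span R ((fun m => monomial m (1 : R)) '' S)) :
    p ^ 2 ∈ Submodule.span R ((fun m => monomial (2 • m) (1 : R)) '' S) := by
  induction hp using Submodule.span_induction with
  | mem x hx =>
    obtain ⟨m, hm, rfl⟩ := hx
    exact Submodule.subset_span ⟨m, hm, by simp [monomial_pow]⟩
  | zero => simp
  | add x y _ _ hx hy => rw [CharTwo.add_sq]; exact add_mem hx hy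
  | smul c x _ hx => rw [smul_pow]; exact Submodule.smul_mem _ _ hx

theorem mul_sq_mem_wtSpan [CharP R 2] {r q : Fin 5 →₀ ℕ} (hr : ∀ j, r j ≤ 1)
    {p b : MvPolynomial (Fin 5) R} (hp : p.IsHomogeneous (∑ j, r j)) (hb : b ∈ wtSpan R q) :
    p * b ^ 2 ∈ wtSpan R (r + 2 • q) := by
  have hp' : p ∈ Submodule.span R
      ((fun m => monomial m (1 : R)) '' {m : Fin 5 →₀ ℕ | ∑ j, m j = ∑ j, r j}) := by
    rw [p.as_sum]
    refine Submodule.sum_mem _ fun m hm => ?_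
    rw [← mul_one (coeff m p), ← smul_eq_mul, ← smul_monomial]
    refine Submodule.smul_mem _ _ (Submodule.subset_span ⟨m, ?_, rfl⟩)
    have := hp (mem_support_iff.mp hm)
    simpa [Finsupp.weight_apply, Finsupp.sum_fintype] using this
  have hb' : b ∈ Submodule.span R
      ((fun m => monomial m (1 : R)) '' {m | ∑ j, m j = ∑ j, q j ∧ wtLe m q}) := by
    refine Submodule.span_mono ?_ hb
    rintro _ ⟨m, rfl, hm⟩
    exact ⟨m, hm, rfl⟩
  have key := Submodule.mul_mem_mul hp' (sq_mem_span_monomial hb')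
  rw [Submodule.span_mul_span] at key
  refine Submodule.span_mono ?_ key
  rintro _ ⟨_, ⟨u, hu, rfl⟩, _, ⟨m, ⟨hm, hmq⟩, rfl⟩, rfl⟩
  refine ⟨u + 2 • m, by simp [monomial_mul], ?_, wtLe_add_two_nsmul hr hu hmq⟩
  simp only [Finsupp.add_apply, Finsupp.smul_apply, Finset.sum_add_distrib, smul_eq_mul,
    ← Finset.mul_sum, hm]
  rw [show ∑ j, u j = ∑ j, r j from hu]

theorem prod_pow_mem_wtSpan [CharP R 2] {l : Fin 5 → MvPolynomial (Fin 5) R}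
    (hl : ∀ i, (l i).IsHomogeneous 1) (n : ℕ) (d : Fin 5 →₀ ℕ) (hd : ∑ j, d j ≤ n) :
    ∏ j, l j ^ d j ∈ wtSpan R d := by
  induction n generalizing d with
  | zero =>
    have h : d = 0 := by
      ext j
      simpa using (Finset.single_le_sum (f := d) (fun _ _ => Nat.zero_le _)
        (Finset.mem_univ j)).trans hd
    subst h
    exact Submodule.subset_span ⟨0, by simp, rfl, .inl fun _ => rfl⟩
  | succ n ih =>
    by_cases h : ∑ j, d j ≤ n
    · exact ih d h
    let r : Fin 5 →₀ ℕ := Finsupp.equivFunOnFinite.symm fun j => d j % 2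
    let q : Fin 5 →₀ ℕ := Finsupp.equivFunOnFinite.symm fun j => d j / 2
    have hrq : d = r + 2 • q := by
      ext j; simp [r, q, Nat.mod_add_div]
    have hsum : ∑ j, d j = ∑ j, r j + 2 * ∑ j, q j := by
      conv_lhs => rw [hrq]
      simp [Finset.sum_add_distrib, Finset.mul_sum]
    have hq := ih q (by omega)
    have hr : ∀ j, r j ≤ 1 := fun j => by
      have : d j % 2 ≤ 1 := by omega
      exact this
    have := mul_sq_mem_wtSpan (p := ∏ j, l j ^ r j) hr
      (IsHomogeneous.prod _ _ _ fun j _ => by simpa using (hl j).pow (r j)) hq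
    rw [← hrq] at this
    convert this using 1
    conv_lhs => rw [hrq]
    rw [← Finset.prod_pow, ← Finset.prod_mul_distrib]
    exact Finset.prod_congr rfl fun j _ => by
      rw [Finsupp.add_apply, pow_add, Finsupp.smul_apply, smul_eq_mul, mul_comm 2, pow_mul]

end Weights

section Stability

variable {R : Type*} [CommRing R]

theorem homogeneousComponent_algHom {A : MvPolynomial (Fin 5) R →ₐ[R] MvPolynomial (Fin 5) R}
    (hA : ∀ i, (A (X i)).IsHomogeneous 1) (n : ℕ) (p : MvPolynomial (Fin 5) R) :
    homogeneousComponent n (A p) = A (homogeneousComponent n p) := by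
  induction p using MvPolynomial.induction_on' with
  | monomial d c =>
    have h : (monomial d c : MvPolynomial (Fin 5) R).IsHomogeneous d.degree :=
      isHomogeneous_monomial c rfl
    have h' : (A (monomial d c)).IsHomogeneous d.degree := by
      rw [aeval_unique A]
      simpa [Function.comp_def] using h.aeval (fun i => A (X i)) hA
    rw [homogeneousComponent_of_mem h, homogeneousComponent_of_mem h']
    split_ifs <;> simp
  | add p q hp hq => simp only [map_add, hp, hq]

theorem algHom_monomial {A : MvPolynomial (Fin 5) R →ₐ[R] MvPolynomial (Fin 5) R}
    (d : Fin 5 →₀ ℕ) : A (monomial d 1) = ∏ j, A (X j) ^ d j := by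
  rw [monomial_eq, C_1, one_mul, Finsupp.prod_fintype _ _ (by simp), map_prod]
  simp

theorem algHom_monomial_mem_wtSpan [CharP R 2]
    {A : MvPolynomial (Fin 5) R →ₐ[R] MvPolynomial (Fin 5) R}
    (hA : ∀ i, (A (X i)).IsHomogeneous 1) (d : Fin 5 →₀ ℕ) : A (monomial d 1) ∈ wtSpan R d := by
  rw [algHom_monomial]
  exact prod_pow_mem_wtSpan hA _ d le_rfl

theorem actGL_X (g : Matrix.GeneralLinearGroup (Fin 5) (ZMod 2)) (i : Fin 5) :
    actGL g (X i) = ∑ j, ((g : Matrix (Fin 5) (Fin 5) (ZMod 2)) i j) • X j := by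
  simp [actGL]

theorem isHomogeneous_actGL_X (g : Matrix.GeneralLinearGroup (Fin 5) (ZMod 2)) (i : Fin 5) :
    (actGL g (X i)).IsHomogeneous 1 := by
  rw [actGL_X]
  exact IsHomogeneous.sum _ _ _ fun j _ =>
    Submodule.smul_mem (homogeneousSubmodule (Fin 5) (ZMod 2) 1) _ (isHomogeneous_X _ _)

theorem Sq_actGL (g : Matrix.GeneralLinearGroup (Fin 5) (ZMod 2)) (p : P5) :
    Sq (actGL g p) = actGL g (Sq p) := by
  have : Sq.comp (actGL g) = (actGL g).comp Sq := by
    refine algHom_ext fun i => ?_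
    have hSq : ∀ j, Sq (X j) = X j + X j ^ 2 := fun j => by simp [Sq]
    have h2 : ∀ a : ZMod 2, a ^ 2 = a := by decide
    simp only [AlgHom.comp_apply, hSq, map_add, map_pow, actGL_X, map_sum, map_smul, smul_add,
      Finset.sum_add_distrib, CharTwo.sum_sq, smul_pow, h2]
  exact DFunLike.congr_fun this p

theorem actGL_mem_hitMinus (g : Matrix.GeneralLinearGroup (Fin 5) (ZMod 2)) {u : P5}
    (hu : u ∈ hitMinus) : actGL g u ∈ hitMinus := by
  obtain ⟨_, p, ⟨v, hv, rfl⟩, hp, rfl⟩ := hu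
  refine ⟨_, actGL g p, ⟨actGL g v, fun m hm => ?_, rfl⟩, ?_, ?_⟩
  · rw [homogeneousComponent_algHom (isHomogeneous_actGL_X g), hv m hm, map_zero]
  · induction hp using Submodule.span_induction with
    | mem x hx =>
      obtain ⟨d, rfl, hd, hd'⟩ := hx
      refine Submodule.span_mono ?_ (algHom_monomial_mem_wtSpan (isHomogeneous_actGL_X g) d)
      rintro _ ⟨m, rfl, hm, hmd⟩
      exact ⟨m, rfl, hm.trans hd, wtLt_of_wtLe hmd hd'⟩
    | zero => simp
    | add x y _ _ hx hy => rw [map_add]; exact add_mem hx hy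
    | smul c x _ hx => rw [map_smul]; exact Submodule.smul_mem _ _ hx
  · rw [map_add, Sq_actGL, homogeneousComponent_algHom (isHomogeneous_actGL_X g)]

variable {K : Type*} [CommRing K] [Algebra (ZMod 2) K]

theorem actExt_mem_hitMinusExt (g : Matrix.GeneralLinearGroup (Fin 5) (ZMod 2))
    {p : MvPolynomial (Fin 5) K} (hp : p ∈ hitMinusExt K) : actExt K g p ∈ hitMinusExt K :=
  fun φ => by
    rw [coeffMap_algHom φ (actGL g) (actExt K g) (by simp [actExt])]
    exact actGL_mem_hitMinus g (hp φ)

theorem algHom_monomial_mem_hitMinusExt [CharP K 2]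
    {A : MvPolynomial (Fin 5) K →ₐ[K] MvPolynomial (Fin 5) K}
    (hA : ∀ i, (A (X i)).IsHomogeneous 1) {d : Fin 5 →₀ ℕ} (hd : ∑ j, d j = 23)
    (hdw : wtLt d [3, 2, 2, 1]) : A (monomial d 1) ∈ hitMinusExt K := by
  refine Submodule.span_le.mpr ?_ (algHom_monomial_mem_wtSpan hA d)
  rintro _ ⟨m, rfl, hm, hmd⟩
  have : monomial m (1 : ZMod 2) ∈ hitMinus :=
    ⟨0, _, ⟨0, by simp, by simp⟩,
      Submodule.subset_span ⟨m, rfl, hm.trans hd, wtLt_of_wtLe hmd hdw⟩, (zero_add _).symm⟩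
  simpa using map_mem_hitMinusExt (K := K) this

end Stability

section Spike

/-- The exponent vector `(15, 7, 1, 0, 0)`. -/
def spike : Fin 5 →₀ ℕ := Finsupp.equivFunOnFinite.symm ![15, 7, 1, 0, 0]

theorem spike_apply (i : Fin 5) : spike i = ![15, 7, 1, 0, 0] i := rfl

theorem choose_spike_eq_zero {n e t : ℕ} (hn : n ∈ [15, 7, 1, 0]) (h : e + t = n) (ht : t ≠ 0) :
    (e.choose t : ZMod 2) = 0 := by
  have key : ∀ n ∈ [15, 7, 1, 0], ∀ t < 16, t ≠ 0 → t ≤ n → ((n - t).choose t) % 2 = 0 := by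
    decide
  have hn' : n ≤ 15 := by
    simp only [List.mem_cons, List.not_mem_nil, or_false] at hn; omega
  have := key n hn t (by omega) ht (by omega)
  rw [show n - t = e by omega] at this
  exact (ZMod.natCast_eq_zero_iff _ _).mpr (Nat.dvd_of_mod_eq_zero this)

theorem coeff_spike_Sq_monomial {e : Fin 5 →₀ ℕ} (he : e ≠ spike) :
    coeff spike (Sq (monomial e 1)) = 0 := by
  classical
  have hX : ∀ j, (Sq (X j)) ^ e j =
      ∑ t ∈ Finset.range (e j + 1), (X j : P5) ^ (e j + t) * C ((e j).choose t : ZMod 2) := by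
    intro j
    have : Sq (X j) = X j * (X j + 1) := by simp [Sq]; ring
    rw [this, mul_pow, add_pow, Finset.mul_sum]
    refine Finset.sum_congr rfl fun t _ => ?_
    rw [pow_add]; simp [mul_assoc]
  rw [algHom_monomial, Finset.prod_congr rfl fun j _ => hX j, Finset.prod_univ_sum, coeff_sum]
  refine Finset.sum_eq_zero fun t _ => ?_
  have hm : ∏ j, (X j : P5) ^ (e j + t j) =
      monomial (Finsupp.equivFunOnFinite.symm fun j => e j + t j) 1 := by
    rw [monomial_eq, C_1, one_mul, Finsupp.prod_fintype _ _ (by simp)]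
    rfl
  rw [Finset.prod_mul_distrib, hm, ← map_prod, mul_comm, C_mul_monomial, coeff_monomial]
  split_ifs with h
  · have hs : ∀ j : Fin 5, ![15, 7, 1, 0, 0] j ∈ [15, 7, 1, 0] := by decide
    have hj : ∀ j, e j + t j = spike j := fun j => DFunLike.congr_fun h j
    obtain ⟨j, hjne⟩ : ∃ j, t j ≠ 0 := by
      by_contra! h0
      exact he (Finsupp.ext fun j => by rw [← hj j, h0 j, add_zero])
    rw [mul_one]
    refine Finset.prod_eq_zero (Finset.mem_univ j) (choose_spike_eq_zero (hs j) (hj j) hjne)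
  · rfl

theorem sum_spike : ∑ j, spike j = 23 := by
  simp only [spike_apply]; decide

theorem wt_spike : ∀ i < 4, wt spike i = [3, 2, 2, 1].getD i 0 := by
  simp only [wt, spike_apply]; decide

theorem not_wtLt_spike : ¬ wtLt spike [3, 2, 2, 1] := by
  rintro ⟨i, -, hi⟩
  rcases lt_or_ge i 4 with h | h
  · exact hi.ne (wt_spike i h)
  · rw [List.getD_eq_default _ _ h] at hi
    exact absurd hi (Nat.not_lt_zero _)

theorem coeff_spike_eq_zero_of_mem {u : P5} (hu : u ∈ hitMinus) : coeff spike u = 0 := by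
  classical
  obtain ⟨_, p, ⟨g, hg, rfl⟩, hp, rfl⟩ := hu
  have hdeg : spike.degree = 23 := by
    rw [Finsupp.degree_eq_sum]; exact sum_spike
  have h1 : coeff spike (homogeneousComponent 23 (Sq g)) = 0 := by
    rw [coeff_homogeneousComponent, if_pos hdeg, g.as_sum, map_sum, coeff_sum]
    refine Finset.sum_eq_zero fun e he => ?_
    rw [← mul_one (coeff e g), ← smul_eq_mul, ← smul_monomial, map_smul, coeff_smul,
      coeff_spike_Sq_monomial, smul_zero]
    rintro rfl
    have := congrArg (coeff spike) (hg 23 le_rfl)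
    rw [coeff_homogeneousComponent, if_pos hdeg, coeff_zero] at this
    exact mem_support_iff.mp he this
  have h2 : coeff spike p = 0 := by
    induction hp using Submodule.span_induction with
    | mem x hx =>
      obtain ⟨d, rfl, -, hd⟩ := hx
      rw [coeff_monomial, if_neg]
      rintro rfl
      exact not_wtLt_spike hd
    | zero => simp
    | add x y _ _ hx hy => rw [coeff_add, hx, hy, add_zero]
    | smul c x _ hx => rw [coeff_smul, hx, smul_zero]
  rw [coeff_add, h1, h2, add_zero]

theorem coeff_spike_eq_zero_of_mem_ext {K : Type*} [CommRing K] [Algebra (ZMod 2) K]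
    {p : MvPolynomial (Fin 5) K} (hp : p ∈ hitMinusExt K) : coeff spike p = 0 := by
  rw [← Module.forall_dual_apply_eq_zero_iff (ZMod 2)]
  intro φ
  rw [← coeff_coeffMap]
  exact coeff_spike_eq_zero_of_mem (hp φ)

end Spike

section SpikeCoefficient

variable {R : Type*} [CommRing R]

theorem coeff_mul_sq [CharP R 2] {a b : MvPolynomial (Fin 5) R} {r w : Fin 5 →₀ ℕ}
    (hr : ∀ j, r j ≤ 1) (ha : a.IsHomogeneous (∑ j, r j)) :
    coeff (r + 2 • w) (a * b ^ 2) = coeff r a * coeff w b ^ 2 := by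
  classical
  have hb : b ^ 2 = (b.expand 2).map (frobenius R 2) := (map_frobenius_expand 2).symm
  rw [coeff_mul, Finset.sum_eq_single (r, 2 • w)]
  · rw [hb, coeff_map, coeff_expand_smul _ (by norm_num), frobenius_def]
  · rintro ⟨u, v⟩ huv hne
    rw [Finset.HasAntidiagonal.mem_antidiagonal] at huv
    by_cases hu : coeff u a = 0
    · rw [hu, zero_mul]
    by_cases hv : ∀ i, 2 ∣ v i
    · exfalso
      have hus : ∑ j, u j = ∑ j, r j := by
        simpa [Finsupp.weight_apply, Finsupp.sum_fintype] using ha hu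
      have hle : ∀ j, r j ≤ u j := fun j => by
        have h1 : u j + v j = r j + 2 * w j := by
          simpa using DFunLike.congr_fun huv j
        have := hr j
        obtain ⟨c, hc⟩ := hv j
        omega
      have hur : u = r := by
        ext j
        exact ((Finset.sum_eq_sum_iff_of_le fun j _ => hle j).mp hus.symm j
          (Finset.mem_univ j)).symm
      subst hur
      exact hne (Prod.ext rfl (add_left_cancel huv))
    · push Not at hv
      obtain ⟨i, hi⟩ := hv
      rw [hb, coeff_map, coeff_expand_of_not_dvd _ hi, map_zero, mul_zero]
  · intro h
    exact absurd (by rw [Finset.HasAntidiagonal.mem_antidiagonal]) h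

/-- The linear form with given coefficients. -/
def linForm (a : Fin 5 → R) : MvPolynomial (Fin 5) R := ∑ j, C (a j) * X j

theorem isHomogeneous_linForm (a : Fin 5 → R) : (linForm a).IsHomogeneous 1 :=
  IsHomogeneous.sum _ _ _ fun j _ => by
    simpa using (isHomogeneous_C _ (a j)).mul (isHomogeneous_X R j)

/-- The exponent vector `(a, b, c, 0, 0)`. -/
def vec3 (a b c : ℕ) : Fin 5 →₀ ℕ := Finsupp.equivFunOnFinite.symm ![a, b, c, 0, 0]

theorem vec3_apply (a b c : ℕ) (i : Fin 5) : vec3 a b c i = ![a, b, c, 0, 0] i := rfl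

theorem coeff_linForm_mul (l : Fin 5 → R) (p : MvPolynomial (Fin 5) R) (a b c : ℕ) :
    coeff (vec3 a b c) (linForm l * p) =
      (if a = 0 then 0 else l 0 * coeff (vec3 (a - 1) b c) p) +
      (if b = 0 then 0 else l 1 * coeff (vec3 a (b - 1) c) p) +
      (if c = 0 then 0 else l 2 * coeff (vec3 a b (c - 1)) p) := by
  have h0 : vec3 a b c - Finsupp.single 0 1 = vec3 (a - 1) b c := by
    ext j; fin_cases j <;> simp [vec3_apply]
  have h1 : vec3 a b c - Finsupp.single 1 1 = vec3 a (b - 1) c := by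
    ext j; fin_cases j <;> simp [vec3_apply]
  have h2 : vec3 a b c - Finsupp.single 2 1 = vec3 a b (c - 1) := by
    ext j; fin_cases j <;> simp [vec3_apply]
  simp only [linForm, Fin.sum_univ_five, add_mul, coeff_add, mul_assoc, coeff_C_mul,
    coeff_X_mul', Finsupp.mem_support_iff, vec3_apply, h0, h1, h2]
  by_cases ha : a = 0 <;> by_cases hb : b = 0 <;> by_cases hc : c = 0 <;> simp [ha, hb, hc]

theorem coeff_vec3_one : coeff (vec3 0 0 0) (1 : MvPolynomial (Fin 5) R) = 1 := by
  have : vec3 0 0 0 = 0 := by ext j; fin_cases j <;> rfl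
  rw [this, coeff_zero_one]

theorem coeff_linForm (l : Fin 5 → R) :
    coeff (vec3 1 0 0) (linForm l) = l 0 ∧ coeff (vec3 0 1 0) (linForm l) = l 1 ∧
      coeff (vec3 0 0 1) (linForm l) = l 2 := by
  rw [← mul_one (linForm l)]
  simp only [coeff_linForm_mul]
  simp [coeff_vec3_one]

/-- The value of the spike coefficient on a product of linear forms whose exponents have the
given binary digits. -/
def spikeVal (l : Fin 5 → Fin 5 → R) (i₁ i₂ i₃ j₁ j₂ k₁ k₂ m : Fin 5) : R :=
  (l i₁ 0 * (l i₂ 1 * l i₃ 2 + l i₂ 2 * l i₃ 1) + l i₁ 1 * (l i₂ 0 * l i₃ 2 + l i₂ 2 * l i₃ 0) +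
      l i₁ 2 * (l i₂ 0 * l i₃ 1 + l i₂ 1 * l i₃ 0)) *
    ((l j₁ 0 * l j₂ 1 + l j₁ 1 * l j₂ 0) *
      ((l k₁ 0 * l k₂ 1 + l k₁ 1 * l k₂ 0) * l m 0 ^ 2) ^ 2) ^ 2

theorem coeff_spike_prod [CharP R 2] (l : Fin 5 → Fin 5 → R) (i₁ i₂ i₃ j₁ j₂ k₁ k₂ m : Fin 5) :
    coeff spike (linForm (l i₁) * linForm (l i₂) * linForm (l i₃) *
      (linForm (l j₁) * linForm (l j₂) *
        (linForm (l k₁) * linForm (l k₂) * linForm (l m) ^ 2) ^ 2) ^ 2) =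
      spikeVal l i₁ i₂ i₃ j₁ j₂ k₁ k₂ m := by
  have hs : spike = vec3 1 1 1 + 2 • (vec3 1 1 0 + 2 • (vec3 1 1 0 + 2 • vec3 1 0 0)) := by
    ext j; fin_cases j <;> rfl
  have hl := fun i => isHomogeneous_linForm (l i)
  have e1 : ∀ j, vec3 1 1 1 j ≤ 1 := by simp only [vec3_apply]; decide
  have e2 : ∀ j, vec3 1 1 0 j ≤ 1 := by simp only [vec3_apply]; decide
  rw [hs, coeff_mul_sq e1 (((hl _).mul (hl _)).mul (hl _)), coeff_mul_sq e2 ((hl _).mul (hl _)),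
    coeff_mul_sq e2 ((hl _).mul (hl _)), spikeVal]
  congr 1
  · rw [mul_assoc]
    simp [coeff_linForm_mul, coeff_linForm]
  congr 2
  · simp [coeff_linForm_mul, coeff_linForm]
  congr 2
  · simp [coeff_linForm_mul, coeff_linForm]
  · rw [(coeff_linForm _).1]

end SpikeCoefficient

section Frobenius

open F32

/-- Coefficients of the linear form that spans the `ζ ^ 2 ^ i`-eigenspace of a Singer cycle. -/
def eigCoeff (i j : Fin 5) : F32 := ζ ^ ((j : ℕ) * 2 ^ (i : ℕ))

/-- The eigenforms of a Singer cycle. -/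
def eig (i : Fin 5) : MvPolynomial (Fin 5) F32 := linForm (eigCoeff i)

/-- The substitution of the eigenforms for the variables. -/
def eigHom : MvPolynomial (Fin 5) F32 →ₐ[F32] MvPolynomial (Fin 5) F32 := aeval eig

/-- Coefficients expressing the variables through the eigenforms. -/
def dualCoeff (j i : Fin 5) : F32 := ζ ^ (![26, 25, 29, 28, 27] j * 2 ^ (i : ℕ))

/-- The substitution inverse to `eigHom`. -/
def dualHom : MvPolynomial (Fin 5) F32 →ₐ[F32] MvPolynomial (Fin 5) F32 :=
  aeval fun j => linForm (dualCoeff j)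

theorem algHom_linForm {R : Type*} [CommRing R]
    (A : MvPolynomial (Fin 5) R →ₐ[R] MvPolynomial (Fin 5) R) (b : Fin 5 → Fin 5 → R)
    (hA : ∀ i, A (X i) = linForm (b i)) (a : Fin 5 → R) :
    A (linForm a) = linForm fun j => ∑ i, a i * b i j := by
  simp only [linForm, map_sum, map_mul, hA, algHom_C, algebraMap_eq, Finset.mul_sum,
    Finset.sum_mul]
  rw [Finset.sum_comm]
  simp only [mul_assoc]

theorem eigHom_X (i : Fin 5) : eigHom (X i) = linForm (eigCoeff i) := by simp [eigHom, eig]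

theorem eigHom_dualHom (p : MvPolynomial (Fin 5) F32) : eigHom (dualHom p) = p := by
  have : eigHom.comp dualHom = AlgHom.id F32 _ := by
    refine algHom_ext fun j => ?_
    have h : ∀ j, (fun m => ∑ i, dualCoeff j i * eigCoeff i m) = Pi.single j 1 := by
      decide +kernel
    rw [AlgHom.comp_apply, dualHom, aeval_X, algHom_linForm _ _ eigHom_X, h]
    simp [linForm, Pi.single_apply, Finset.sum_ite_eq']
  exact DFunLike.congr_fun this p

theorem mem_span_eigHom {f : P5} (hf : f ∈ PLe 23 [3, 2, 2, 1]) :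
    map (algebraMap (ZMod 2) F32) f ∈ Submodule.span F32
      {p | ∃ d : Fin 5 →₀ ℕ, p = eigHom (monomial d 1) ∧ ∑ j, d j = 23 ∧
        (wtLt d [3, 2, 2, 1] ∨ hasWt d [3, 2, 2, 1])} := by
  induction hf using Submodule.span_induction with
  | mem x hx =>
    obtain ⟨d, rfl, hd, hdw⟩ := hx
    have key := algHom_monomial_mem_wtSpan (A := dualHom)
      (fun i => by simpa [dualHom] using isHomogeneous_linForm (dualCoeff i)) d
    have := Submodule.mem_map_of_mem (f := eigHom.toLinearMap) key
    rw [AlgHom.toLinearMap_apply, eigHom_dualHom, wtSpan, Submodule.map_span] at this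
    rw [map_monomial, map_one]
    refine Submodule.span_mono ?_ this
    rintro _ ⟨_, ⟨m, rfl, hm, hmd⟩, rfl⟩
    exact ⟨m, rfl, hm.trans hd, wtLt_or_hasWt_of_wtLe hmd hdw⟩
  | zero => simp
  | add x y _ _ hx hy => rw [map_add]; exact add_mem hx hy
  | smul c x _ hx =>
    rw [smul_eq_C_mul, map_mul, map_C, C_mul']
    exact Submodule.smul_mem _ _ hx

/-- A Singer cycle in `GL_5(F_2)`, acting diagonally on the eigenforms. -/
def singer : Matrix.GeneralLinearGroup (Fin 5) (ZMod 2) where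
  val := !![0, 0, 0, 0, 1; 1, 0, 0, 0, 0; 0, 1, 0, 0, 1; 0, 0, 1, 0, 0; 0, 0, 0, 1, 0]
  inv := !![0, 1, 0, 0, 0; 1, 0, 1, 0, 0; 0, 0, 0, 1, 0; 0, 0, 0, 0, 1; 1, 0, 0, 0, 0]
  val_inv := by decide
  inv_val := by decide

/-- The element of `GL_5(F_2)` permuting the eigenforms cyclically. -/
def frob : Matrix.GeneralLinearGroup (Fin 5) (ZMod 2) where
  val := !![1, 0, 0, 0, 1; 0, 0, 0, 1, 0; 0, 1, 0, 0, 1; 0, 0, 0, 1, 1; 0, 0, 1, 0, 0]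
  inv := !![1, 1, 0, 1, 0; 0, 1, 1, 1, 0; 0, 0, 0, 0, 1; 0, 1, 0, 0, 0; 0, 1, 0, 1, 0]
  val_inv := by decide
  inv_val := by decide

theorem actExt_X {K : Type*} [CommRing K] [Algebra (ZMod 2) K]
    (g : Matrix.GeneralLinearGroup (Fin 5) (ZMod 2)) (i : Fin 5) :
    actExt K g (X i) =
      linForm fun j => algebraMap (ZMod 2) K ((g : Matrix (Fin 5) (Fin 5) (ZMod 2)) i j) := by
  simp [actExt, actGL_X, linForm, smul_eq_C_mul]

theorem F32.algebraMap_apply (a : ZMod 2) : algebraMap (ZMod 2) F32 a = if a = 0 then 0 else 1 := by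
  have h : ∀ a : ZMod 2, a = 0 ∨ a = 1 := by decide
  rcases h a with rfl | rfl <;> simp

theorem actExt_singer (i : Fin 5) : actExt F32 singer (eig i) = C (ζ ^ 2 ^ (i : ℕ)) * eig i := by
  have h : ∀ i : Fin 5, (fun j => ∑ m, eigCoeff i m *
      (if (singer : Matrix (Fin 5) (Fin 5) (ZMod 2)) m j = 0 then 0 else 1)) =
      fun j => ζ ^ 2 ^ (i : ℕ) * eigCoeff i j := by
    decide +kernel
  rw [eig, algHom_linForm _ _ (actExt_X singer)]
  simp only [F32.algebraMap_apply, h]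
  simp only [linForm, Finset.mul_sum, C_mul, mul_assoc]

theorem actExt_frob (i : Fin 5) : actExt F32 frob (eig i) = eig (i + 1) := by
  have h : ∀ i : Fin 5, (fun j => ∑ m, eigCoeff i m *
      (if (frob : Matrix (Fin 5) (Fin 5) (ZMod 2)) m j = 0 then 0 else 1)) =
      eigCoeff (i + 1) := by
    decide +kernel
  rw [eig, algHom_linForm _ _ (actExt_X frob)]
  simp only [F32.algebraMap_apply, h]
  rfl

theorem SqExt_eig (i : Fin 5) : SqExt F32 (eig i) = eig i + eig (i - 1) ^ 2 := by
  have h : ∀ i j : Fin 5, eigCoeff (i - 1) j ^ 2 = eigCoeff i j := by decide +kernel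
  have hX : ∀ j, SqExt F32 (X j) = X j + X j ^ 2 := fun j => by simp [SqExt]
  simp only [eig, linForm, CharTwo.sum_sq, mul_pow, ← C_pow, h, map_sum, map_mul, hX, mul_add,
    Finset.sum_add_distrib, algHom_C, algebraMap_eq]

end Frobenius

section Averaging

open F32

/-- The sum of the first `n` powers of an endomorphism. -/
def powSum {R : Type*} [CommRing R] (L : Module.End R (MvPolynomial (Fin 5) R)) (n : ℕ) :
    Module.End R (MvPolynomial (Fin 5) R) :=
  ∑ j ∈ Finset.range n, L ^ j

theorem powSum_sub_mem {R : Type*} [CommRing R] [CharP R 2]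
    {U : Submodule R (MvPolynomial (Fin 5) R)} {L : Module.End R (MvPolynomial (Fin 5) R)}
    (hL : ∀ u ∈ U, L u ∈ U) {p : MvPolynomial (Fin 5) R} (hp : L p - p ∈ U) {n : ℕ}
    (hn : Odd n) : powSum L n p - p ∈ U := by
  have h : ∀ j, (L ^ j) p - p ∈ U := by
    intro j
    induction j with
    | zero => simp
    | succ j ih =>
      have := add_mem (hL _ ih) hp
      rwa [map_sub, sub_add_sub_cancel, ← Module.End.mul_apply, ← pow_succ'] at this
  have h2 : p = ∑ _j ∈ Finset.range n, p := by
    rw [Finset.sum_const, Finset.card_range, ← Nat.cast_smul_eq_nsmul R,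
      (CharTwo.natCast_eq_ite n).trans (if_neg (Nat.not_even_iff_odd.mpr hn)), one_smul]
  nth_rewrite 2 [h2]
  rw [powSum, LinearMap.sum_apply, ← Finset.sum_sub_distrib]
  exact Submodule.sum_mem _ fun j _ => h j

/-- Exponent vectors as tuples, for computation. -/
abbrev Exps : Type := ℕ × ℕ × ℕ × ℕ × ℕ

/-- The exponent vector of a tuple. -/
def toVec (t : Exps) : Fin 5 →₀ ℕ :=
  Finsupp.equivFunOnFinite.symm ![t.1, t.2.1, t.2.2.1, t.2.2.2.1, t.2.2.2.2]

theorem exists_toVec (d : Fin 5 →₀ ℕ) : ∃ t, toVec t = d :=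
  ⟨(d 0, d 1, d 2, d 3, d 4), by ext j; fin_cases j <;> rfl⟩

/-- The degree of a tuple. -/
def Exps.deg (t : Exps) : ℕ := t.1 + (t.2.1 + (t.2.2.1 + (t.2.2.2.1 + t.2.2.2.2)))

theorem sum_toVec (t : Exps) : ∑ j, toVec t j = t.deg := by
  simp only [Fin.sum_univ_five, Exps.deg, ← add_assoc]; rfl

/-- The weight by which `singer` acts on a monomial in the eigenforms. -/
def Exps.char (t : Exps) : ℕ :=
  t.1 + (2 * t.2.1 + (4 * t.2.2.1 + (8 * t.2.2.2.1 + 16 * t.2.2.2.2)))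

/-- Cyclic rotation of a tuple. -/
def Exps.rot (t : Exps) : Exps := (t.2.2.2.2, t.1, t.2.1, t.2.2.1, t.2.2.2.1)

/-- The monomial in the eigenforms with exponents `t`. -/
def eigMon (t : Exps) : MvPolynomial (Fin 5) F32 :=
  eig 0 ^ t.1 * eig 1 ^ t.2.1 * eig 2 ^ t.2.2.1 * eig 3 ^ t.2.2.2.1 * eig 4 ^ t.2.2.2.2

theorem eigHom_monomial (t : Exps) : eigHom (monomial (toVec t) 1) = eigMon t := by
  rw [algHom_monomial, Fin.prod_univ_five]
  simp only [eigHom, aeval_X]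
  rfl

/-- The averaging operator of the Singer cycle. -/
def singerSum : Module.End F32 (MvPolynomial (Fin 5) F32) :=
  powSum (actExt F32 singer).toLinearMap 31

/-- The averaging operator of the cyclic permutation of the eigenforms. -/
def frobSum : Module.End F32 (MvPolynomial (Fin 5) F32) :=
  powSum (actExt F32 frob).toLinearMap 5

theorem frobSum_mem {p : MvPolynomial (Fin 5) F32} (hp : p ∈ hitMinusExt F32) :
    frobSum p ∈ hitMinusExt F32 := by
  rw [frobSum, powSum, LinearMap.sum_apply]
  refine Submodule.sum_mem _ fun j hj => ?_
  clear hj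
  induction j with
  | zero => simpa
  | succ j ih =>
    rw [pow_succ', Module.End.mul_apply]
    exact actExt_mem_hitMinusExt frob ih

theorem powSum_actExt_sub_mem (g : Matrix.GeneralLinearGroup (Fin 5) (ZMod 2))
    {p : MvPolynomial (Fin 5) F32} (hp : actExt F32 g p - p ∈ hitMinusExt F32) {n : ℕ}
    (hn : Odd n) : powSum (actExt F32 g).toLinearMap n p - p ∈ hitMinusExt F32 := by
  refine powSum_sub_mem (fun u hu => ?_) ?_ hn
  · rw [AlgHom.toLinearMap_apply]
    exact actExt_mem_hitMinusExt g hu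
  · rwa [AlgHom.toLinearMap_apply]

theorem sub_average_mem {p : MvPolynomial (Fin 5) F32}
    (hp : ∀ g, actExt F32 g p - p ∈ hitMinusExt F32) :
    p - frobSum (singerSum p) ∈ hitMinusExt F32 := by
  have h1 : singerSum p - p ∈ hitMinusExt F32 :=
    powSum_actExt_sub_mem singer (hp singer) (by decide)
  have h2 : frobSum p - p ∈ hitMinusExt F32 :=
    powSum_actExt_sub_mem frob (hp frob) (by decide)
  have h3 := neg_mem (add_mem (frobSum_mem h1) h2)
  rw [map_sub, sub_add_sub_cancel, neg_sub] at h3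
  exact h3

theorem singerSum_eigMon (t : Exps) :
    singerSum (eigMon t) = if t.char % 31 = 0 then eigMon t else 0 := by
  have h : ∀ j, ((actExt F32 singer).toLinearMap ^ j) (eigMon t) =
      (ζ ^ t.char) ^ j • eigMon t := by
    intro j
    induction j with
    | zero => simp
    | succ j ih =>
      have h1 : actExt F32 singer (eigMon t) = ζ ^ t.char • eigMon t := by
        have h0 : t.char = 1 * t.1 + 2 * t.2.1 + 4 * t.2.2.1 + 8 * t.2.2.2.1 + 16 * t.2.2.2.2 := by
          simp only [Exps.char]; ring
        rw [smul_eq_C_mul, h0]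
        simp only [eigMon, map_mul, map_pow, actExt_singer, mul_pow, ← pow_mul, pow_add]
        norm_num
        ring
      rw [pow_succ', Module.End.mul_apply, ih, map_smul, AlgHom.toLinearMap_apply, h1, smul_smul,
        pow_succ]
  have h31 : ζ ^ 31 = 1 := by decide +kernel
  have hsum : ∀ c < 31, ∑ j ∈ Finset.range 31, (ζ ^ c) ^ j = if c = 0 then 1 else 0 := by
    decide +kernel
  have hc : ζ ^ t.char = ζ ^ (t.char % 31) := by
    conv_lhs => rw [← Nat.div_add_mod t.char 31, pow_add, pow_mul, h31, one_pow, one_mul]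
  rw [singerSum, powSum, LinearMap.sum_apply, Finset.sum_congr rfl fun j _ => h j,
    ← Finset.sum_smul, hc, hsum _ (Nat.mod_lt _ (by norm_num))]
  split_ifs <;> simp

theorem singerSum_mem_span {p : MvPolynomial (Fin 5) F32}
    (hp : p ∈ Submodule.span F32
      {p | ∃ d : Fin 5 →₀ ℕ, p = eigHom (monomial d 1) ∧ ∑ j, d j = 23 ∧
        (wtLt d [3, 2, 2, 1] ∨ hasWt d [3, 2, 2, 1])}) :
    singerSum p ∈ Submodule.span F32 {p | ∃ t : Exps, p = eigMon t ∧ t.deg = 23 ∧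
      t.char % 31 = 0 ∧ (wtLt (toVec t) [3, 2, 2, 1] ∨ hasWt (toVec t) [3, 2, 2, 1])} := by
  induction hp using Submodule.span_induction with
  | mem x hx =>
    obtain ⟨d, rfl, hd, hdw⟩ := hx
    obtain ⟨t, rfl⟩ := exists_toVec d
    rw [eigHom_monomial, singerSum_eigMon]
    split_ifs with h
    · exact Submodule.subset_span ⟨t, rfl, by rwa [← sum_toVec], h, hdw⟩
    · exact zero_mem _
  | zero => simp
  | add x y _ _ hx hy => rw [map_add]; exact add_mem hx hy
  | smul c x _ hx => rw [map_smul]; exact Submodule.smul_mem _ _ hx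

theorem actExt_frob_eigMon (t : Exps) : actExt F32 frob (eigMon t) = eigMon t.rot := by
  have h1 : (1 : Fin 5) + 1 = 2 := rfl
  have h2 : (2 : Fin 5) + 1 = 3 := rfl
  have h3 : (3 : Fin 5) + 1 = 4 := rfl
  have h4 : (4 : Fin 5) + 1 = 0 := rfl
  simp only [eigMon, map_mul, map_pow, actExt_frob, Exps.rot, zero_add, h1, h2, h3, h4]
  ring

theorem frobSum_eigMon (t : Exps) :
    frobSum (eigMon t) = eigMon t + eigMon t.rot + eigMon t.rot.rot + eigMon t.rot.rot.rot +
      eigMon t.rot.rot.rot.rot := by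
  simp only [frobSum, powSum, LinearMap.add_apply, Finset.sum_range_succ, Finset.sum_range_zero,
    pow_succ', pow_zero, Module.End.mul_apply, Module.End.one_apply, AlgHom.toLinearMap_apply,
    actExt_frob_eigMon, zero_add]

theorem frobSum_eigMon_rot (t : Exps) : frobSum (eigMon t.rot) = frobSum (eigMon t) := by
  rw [frobSum_eigMon, frobSum_eigMon]
  change _ + eigMon t = _
  ring

end Averaging

section Reduction

/-- The polynomials whose average over `frob` is hit modulo smaller weights. -/
def avgHit : Submodule F32 (MvPolynomial (Fin 5) F32) := (hitMinusExt F32).comap frobSum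

theorem hitMinusExt_le_avgHit : hitMinusExt F32 ≤ avgHit := fun _ hp => frobSum_mem hp

theorem eigMon_rot_sub_mem (t : Exps) : eigMon t.rot - eigMon t ∈ avgHit := by
  rw [avgHit, Submodule.mem_comap, map_sub, frobSum_eigMon_rot, sub_self]
  exact zero_mem _

/-- The number of entries of a tuple with bit `i` equal to `1`. -/
def Exps.wt (t : Exps) (i : ℕ) : ℕ :=
  t.1 / 2 ^ i % 2 + (t.2.1 / 2 ^ i % 2 + (t.2.2.1 / 2 ^ i % 2 +
    (t.2.2.2.1 / 2 ^ i % 2 + t.2.2.2.2 / 2 ^ i % 2)))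

theorem wt_toVec (t : Exps) (i : ℕ) : wt (toVec t) i = t.wt i := by
  have h : ∀ n, (if Nat.testBit n i then 1 else 0) = n / 2 ^ i % 2 := fun n => by
    rw [Nat.testBit_eq_decide_div_mod_eq]
    rcases Nat.mod_two_eq_zero_or_one (n / 2 ^ i) with h | h <;> simp [h]
  simp only [wt, Finset.card_filter, Fin.sum_univ_five, h, Exps.wt, ← add_assoc]
  rfl

/-- Whether a tuple has degree 23 and weight vector less than `(3, 2, 2, 1)`. -/
def Exps.low (t : Exps) : Bool :=
  t.deg == 23 && (Nat.blt (t.wt 0) 3 || (t.wt 0 == 3 && (Nat.blt (t.wt 1) 2 ||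
    (t.wt 1 == 2 && (Nat.blt (t.wt 2) 2 || (t.wt 2 == 2 && Nat.blt (t.wt 3) 1))))))

theorem eigMon_mem_of_wtLt {t : Exps} (hd : t.deg = 23) (ht : wtLt (toVec t) [3, 2, 2, 1]) :
    eigMon t ∈ hitMinusExt F32 := by
  rw [← eigHom_monomial]
  refine algHom_monomial_mem_hitMinusExt (fun i => ?_) (by rw [sum_toVec, hd]) ht
  rw [eigHom_X]
  exact isHomogeneous_linForm _

theorem eigMon_mem_of_low {t : Exps} (ht : t.low = true) : eigMon t ∈ avgHit := by
  simp only [Exps.low, Bool.and_eq_true, Bool.or_eq_true, beq_iff_eq, Nat.blt_eq,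
    ← wt_toVec] at ht
  obtain ⟨hd, h⟩ := ht
  refine hitMinusExt_le_avgHit (eigMon_mem_of_wtLt hd ?_)
  rcases h with h | ⟨h0, h | ⟨h1, h | ⟨h2, h⟩⟩⟩
  · exact ⟨0, fun j hj => absurd hj (by omega), h⟩
  · exact ⟨1, fun j hj => by interval_cases j; exact h0, h⟩
  · exact ⟨2, fun j hj => by interval_cases j; exacts [h0, h1], h⟩
  · exact ⟨3, fun j hj => by interval_cases j; exacts [h0, h1, h2], h⟩

/-- Encoding of tuples used to choose representatives. -/
def Exps.key (t : Exps) : ℕ :=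
  t.2.2.2.2 + 32 * (t.2.2.2.1 + 32 * (t.2.2.1 + 32 * (t.2.1 + 32 * t.1)))

/-- The tuple with smaller key. -/
def Exps.min (s t : Exps) : Exps := bif Nat.ble s.key t.key then s else t

/-- The rotation of a tuple with smallest key. -/
def Exps.canon (t : Exps) : Exps :=
  t.min (t.rot.min (t.rot.rot.min (t.rot.rot.rot.min t.rot.rot.rot.rot)))

theorem Exps.canon_induction {P : Exps → Prop} (hrot : ∀ s, P s → P s.rot) {t : Exps}
    (ht : P t) : P t.canon := by
  have hmin : ∀ {s u : Exps}, P s → P u → P (s.min u) := fun {s u} hs hu => by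
    rw [Exps.min]
    cases Nat.ble s.key u.key <;> assumption
  have h1 := hrot _ ht
  have h2 := hrot _ h1
  have h3 := hrot _ h2
  exact hmin ht (hmin h1 (hmin h2 (hmin h3 (hrot _ h3))))

theorem eigMon_canon_sub_mem (t : Exps) : eigMon t.canon - eigMon t ∈ avgHit := by
  refine Exps.canon_induction (P := fun s => eigMon s - eigMon t ∈ avgHit) (fun s hs => ?_) ?_
  · rw [← sub_add_sub_cancel _ (eigMon s)]
    exact add_mem (eigMon_rot_sub_mem s) hs
  · rw [sub_self]
    exact zero_mem _

/-- The sum of the monomials in the eigenforms with exponents in a list. -/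
def evalSum (l : List Exps) : MvPolynomial (Fin 5) F32 := (l.map eigMon).sum

/-- Add a tuple to a sum modulo 2. -/
def toggle (t : Exps) (l : List Exps) : List Exps := bif l.elem t then l.erase t else t :: l

theorem evalSum_toggle (t : Exps) (l : List Exps) :
    evalSum (toggle t l) = eigMon t + evalSum l := by
  rw [toggle]
  cases h : l.elem t
  · simp [evalSum]
  · have h1 : t ∈ l := by simpa using h
    have h2 := ((List.perm_cons_erase h1).map eigMon).sum_eq
    rw [List.map_cons, List.sum_cons] at h2
    rw [evalSum, evalSum, h2, ← add_assoc, CharTwo.add_self_eq_zero, zero_add, cond_true]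

/-- Reduction of a sum of monomials modulo `avgHit`. -/
def reduce (l : List Exps) : List Exps :=
  l.foldr (fun t r => bif t.low then r else toggle t.canon r) []

theorem evalSum_reduce_sub_mem (l : List Exps) : evalSum (reduce l) - evalSum l ∈ avgHit := by
  induction l with
  | nil => simp [reduce]
  | cons t l ih =>
    have hc : evalSum (t :: l) = eigMon t + evalSum l := by simp [evalSum]
    have hr : reduce (t :: l) =
      bif t.low then reduce l else toggle t.canon (reduce l) := rfl
    rw [hc, hr]
    cases h : t.low
    · rw [cond_false, evalSum_toggle, add_sub_add_comm]
      exact add_mem (eigMon_canon_sub_mem t) ih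
    · rw [cond_true, add_comm, ← sub_sub]
      exact sub_mem ih (eigMon_mem_of_low h)

/-- The exponents in the expansion of the `n`-th power of a binomial modulo 2, for
`n < 2 ^ k`. -/
def binTerms : ℕ → ℕ → List (ℕ × ℕ)
  | 0, _ => [(0, 0)]
  | k + 1, n =>
    let l := (binTerms k (n / 2)).map fun p => (2 * p.1, 2 * p.2)
    bif n % 2 == 0 then l
    else l.map (fun p => (p.1 + 1, p.2)) ++ l.map fun p => (p.1, p.2 + 1)

theorem add_pow_eq_sum_binTerms {R : Type*} [CommRing R] [CharP R 2] (k : ℕ) :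
    ∀ (n : ℕ) (a b : R), n < 2 ^ k →
      (a + b) ^ n = ((binTerms k n).map fun p => a ^ p.1 * b ^ p.2).sum := by
  induction k with
  | zero =>
    intro n a b hn
    obtain rfl : n = 0 := by omega
    simp [binTerms]
  | succ k ih =>
    intro n a b hn
    have h1 : (a + b) ^ n = (a + b) ^ (n % 2) * (a ^ 2 + b ^ 2) ^ (n / 2) := by
      rw [← CharTwo.add_sq, ← pow_mul, ← pow_add, Nat.mod_add_div]
    rw [h1, ih (n / 2) _ _ (by omega), binTerms]
    rcases Nat.mod_two_eq_zero_or_one n with h | h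
    · simp [h, Function.comp_def, pow_mul]
    · rw [h, pow_one, add_mul, ← List.sum_map_mul_left, ← List.sum_map_mul_left]
      simp only [cond_false, List.map_append, List.map_map, Function.comp_def, List.sum_append,
        pow_add, pow_one, pow_mul, Nat.reduceBEq]
      congr 2 <;> (apply List.map_congr_left; intros; ring)

theorem eigMon_add (s t : Exps) : eigMon (s + t) = eigMon s * eigMon t := by
  simp only [eigMon, Prod.fst_add, Prod.snd_add, pow_add]
  ring

/-- The exponents of a product of sums of monomials. -/
def mulTerms (l r : List Exps) : List Exps := l.flatMap fun s => r.map (s + ·)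

theorem evalSum_mulTerms (l r : List Exps) :
    evalSum (mulTerms l r) = evalSum l * evalSum r := by
  induction l with
  | nil => simp [mulTerms, evalSum]
  | cons s l ih =>
    have : mulTerms (s :: l) r = r.map (s + ·) ++ mulTerms l r := rfl
    rw [this]
    simp only [evalSum, List.map_append, List.sum_append, List.map_cons, List.sum_cons,
      add_mul] at ih ⊢
    rw [ih, List.map_map]
    simp only [Function.comp_def, eigMon_add, List.sum_map_mul_left]

/-- The exponents of the monomials in the total square of a monomial in the eigenforms. -/
def sqTerms (t : Exps) : List Exps :=
  mulTerms ((binTerms 5 t.1).map fun p => (p.1, 0, 0, 0, 2 * p.2)) <|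
  mulTerms ((binTerms 5 t.2.1).map fun p => (2 * p.2, p.1, 0, 0, 0)) <|
  mulTerms ((binTerms 5 t.2.2.1).map fun p => (0, 2 * p.2, p.1, 0, 0)) <|
  mulTerms ((binTerms 5 t.2.2.2.1).map fun p => (0, 0, 2 * p.2, p.1, 0)) <|
  (binTerms 5 t.2.2.2.2).map fun p => (0, 0, 0, 2 * p.2, p.1)

theorem SqExt_eigMon {t : Exps} (ht : t.deg < 23) :
    SqExt F32 (eigMon t) = evalSum (sqTerms t) := by
  have key : ∀ (i : Fin 5) (f : ℕ × ℕ → Exps) (n : ℕ), n < 32 →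
      (∀ p, eigMon (f p) = eig i ^ p.1 * (eig (i - 1) ^ 2) ^ p.2) →
      evalSum ((binTerms 5 n).map f) = SqExt F32 (eig i) ^ n := by
    intro i f n hn hf
    rw [SqExt_eig, add_pow_eq_sum_binTerms 5 n _ _ hn, evalSum, List.map_map]
    simp only [Function.comp_def, hf]
  rw [Exps.deg] at ht
  have e0 : (0 : Fin 5) - 1 = 4 := rfl
  have e1 : (1 : Fin 5) - 1 = 0 := rfl
  have e2 : (2 : Fin 5) - 1 = 1 := rfl
  have e3 : (3 : Fin 5) - 1 = 2 := rfl
  have e4 : (4 : Fin 5) - 1 = 3 := rfl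
  rw [sqTerms]
  simp only [evalSum_mulTerms]
  rw [key 0 _ t.1 (by omega) fun p => by rw [e0]; simp only [eigMon]; ring,
    key 1 _ t.2.1 (by omega) fun p => by rw [e1]; simp only [eigMon]; ring,
    key 2 _ t.2.2.1 (by omega) fun p => by rw [e2]; simp only [eigMon]; ring,
    key 3 _ t.2.2.2.1 (by omega) fun p => by rw [e3]; simp only [eigMon]; ring,
    key 4 _ t.2.2.2.2 (by omega) fun p => by rw [e4]; simp only [eigMon]; ring]
  simp only [eigMon, map_mul, map_pow, mul_assoc]

theorem isHomogeneous_eigMon (t : Exps) : (eigMon t).IsHomogeneous t.deg := by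
  have h : ∀ (i : Fin 5) (n : ℕ), (eig i ^ n).IsHomogeneous n := fun i n => by
    simpa [eig] using (isHomogeneous_linForm (eigCoeff i)).pow n
  have := ((((h 0 t.1).mul (h 1 t.2.1)).mul (h 2 t.2.2.1)).mul (h 3 t.2.2.2.1)).mul
    (h 4 t.2.2.2.2)
  simpa only [eigMon, Exps.deg, ← add_assoc] using this

theorem homogeneousComponent_evalSum (l : List Exps) :
    homogeneousComponent 23 (evalSum l) = evalSum (l.filter fun t => t.deg == 23) := by
  induction l with
  | nil => simp [evalSum]
  | cons t l ih =>
    have hc : ∀ l, evalSum (t :: l) = eigMon t + evalSum l := fun l => by simp [evalSum]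
    rw [hc, map_add, ih, homogeneousComponent_of_mem (isHomogeneous_eigMon t), List.filter_cons]
    by_cases h : t.deg = 23
    · simp [h, hc]
    · simp [h, Ne.symm h]

/-- The exponents of the degree 23 part of the total square of a monomial of lower degree. -/
def hitTerms (t : Exps) : List Exps :=
  bif Nat.blt t.deg 23 then (sqTerms t).filter fun s => s.deg == 23 else []

theorem evalSum_hitTerms_mem (t : Exps) : evalSum (hitTerms t) ∈ avgHit := by
  rw [hitTerms]
  cases h : Nat.blt t.deg 23
  · simp [evalSum]
  · have ht : t.deg < 23 := by simpa using h
    rw [cond_true, ← homogeneousComponent_evalSum, ← SqExt_eigMon ht]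
    refine hitMinusExt_le_avgHit (homogeneousComponent_SqExt_mem fun m hm => ?_)
    rw [homogeneousComponent_of_mem (isHomogeneous_eigMon t), if_neg (by omega)]

/-- Exponents of monomials that span modulo `avgHit`. -/
def basisExps : Fin 6 → Exps := ![
  (0, 1, 4, 15, 3), (0, 1, 12, 3, 7), (0, 2, 7, 1, 13),
  (0, 3, 3, 13, 4), (0, 3, 5, 10, 5), (0, 4, 11, 7, 1)]

/-- Relations: each entry consists of a tuple, indices of basis tuples, and tuples whose total
squares show that the sum of the monomials with these exponents reduces to zero. -/
def relations : List (Exps × List (Fin 6) × List Exps) := [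
  ((0, 3, 9, 4, 7), [0, 1, 2],
    [(0, 3, 7, 3, 8), (2, 3, 9, 4, 3), (0, 7, 5, 1, 9), (1, 7, 1, 9, 4), (0, 2, 3, 3, 13),
    (0, 3, 3, 9, 6), (1, 3, 9, 2, 6), (0, 1, 4, 7, 7)]),
  ((0, 4, 15, 1, 3), [5],
    [(0, 4, 11, 3, 3)]),
  ((0, 5, 2, 11, 5), [1, 3, 4, 5],
    [(0, 4, 11, 3, 3), (1, 3, 1, 14, 2), (2, 3, 9, 4, 3), (0, 7, 5, 1, 9), (1, 1, 12, 3, 5),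
    (1, 5, 6, 5, 5), (1, 7, 1, 9, 4), (0, 3, 3, 9, 6), (0, 3, 5, 6, 7), (0, 5, 2, 7, 7),
    (1, 3, 9, 2, 6), (1, 7, 3, 4, 6), (0, 4, 7, 5, 3), (1, 3, 5, 4, 6)]),
  ((0, 6, 1, 3, 13), [2, 3],
    [(0, 2, 3, 3, 13)]),
  ((0, 7, 1, 9, 6), [2, 3],
    [(0, 3, 7, 3, 8), (0, 7, 3, 2, 9), (2, 3, 9, 4, 3), (0, 7, 5, 1, 9), (1, 3, 9, 4, 5),
    (1, 7, 1, 9, 4), (0, 2, 3, 3, 13), (1, 3, 9, 2, 6)]),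
  ((0, 7, 5, 3, 8), [0, 1, 3],
    [(0, 3, 7, 3, 8), (0, 7, 3, 2, 9), (2, 3, 9, 4, 3), (1, 3, 9, 4, 5), (1, 7, 1, 9, 4),
    (0, 3, 3, 9, 6), (0, 1, 4, 7, 7)]),
  ((0, 7, 7, 0, 9), [0, 1],
    [(0, 1, 4, 7, 7)]),
  ((0, 12, 3, 5, 3), [0, 1, 3, 5],
    [(0, 3, 7, 3, 8), (0, 4, 11, 3, 3), (0, 7, 3, 2, 9), (2, 3, 9, 4, 3), (1, 3, 9, 4, 5),
    (1, 7, 1, 9, 4), (0, 3, 3, 9, 6), (0, 1, 4, 7, 7), (0, 4, 7, 5, 3)]),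
  ((1, 1, 1, 6, 14), [0, 5],
    [(0, 4, 11, 3, 3), (1, 1, 1, 4, 15)]),
  ((1, 1, 14, 2, 5), [0, 3, 5],
    [(0, 3, 7, 3, 8), (0, 4, 11, 3, 3), (0, 7, 3, 2, 9), (2, 3, 9, 4, 3), (1, 1, 12, 3, 5),
    (1, 3, 9, 4, 5), (1, 7, 1, 9, 4), (0, 3, 3, 9, 6), (0, 1, 4, 7, 7), (0, 4, 7, 5, 3)]),
  ((1, 2, 1, 12, 7), [1],
    [(1, 12, 3, 3, 2)]),
  ((1, 2, 5, 6, 9), [1, 3, 4, 5],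
    [(0, 4, 11, 3, 3), (1, 2, 5, 2, 11), (1, 3, 1, 14, 2), (2, 3, 9, 4, 3), (0, 7, 5, 1, 9),
    (1, 1, 12, 3, 5), (1, 5, 6, 5, 5), (1, 7, 1, 9, 4), (0, 3, 3, 9, 6), (0, 3, 5, 6, 7),
    (0, 5, 2, 7, 7), (1, 3, 9, 2, 6), (1, 7, 3, 4, 6), (0, 4, 7, 5, 3), (1, 3, 5, 4, 6)]),
  ((1, 3, 5, 12, 2), [0, 3, 5],
    [(0, 3, 7, 3, 8), (0, 4, 11, 3, 3), (0, 7, 3, 2, 9), (1, 3, 1, 14, 2), (2, 3, 9, 4, 3),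
    (1, 1, 12, 3, 5), (1, 3, 9, 4, 5), (1, 7, 1, 9, 4), (0, 3, 3, 9, 6), (0, 1, 4, 7, 7),
    (0, 4, 7, 5, 3)]),
  ((1, 3, 9, 6, 4), [2],
    [(0, 3, 7, 3, 8), (0, 7, 3, 2, 9), (2, 3, 9, 4, 3), (0, 7, 5, 1, 9), (1, 3, 9, 4, 5),
    (1, 7, 1, 9, 4), (0, 2, 3, 3, 13), (0, 3, 3, 9, 6), (1, 3, 9, 2, 6)]),
  ((1, 4, 2, 7, 9), [0, 2, 5],
    [(0, 3, 7, 3, 8), (0, 4, 11, 3, 3), (0, 7, 3, 2, 9), (1, 3, 1, 14, 2), (1, 4, 2, 3, 11),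
    (2, 3, 9, 4, 3), (1, 1, 12, 3, 5), (1, 3, 9, 4, 5), (1, 7, 1, 9, 4), (0, 2, 3, 3, 13),
    (0, 3, 3, 9, 6), (0, 1, 4, 7, 7), (0, 4, 7, 5, 3), (1, 3, 5, 4, 6)]),
  ((1, 4, 6, 1, 11), [0, 2, 5],
    [(0, 3, 7, 3, 8), (0, 4, 11, 3, 3), (0, 7, 3, 2, 9), (1, 3, 1, 14, 2), (2, 3, 9, 4, 3),
    (1, 1, 12, 3, 5), (1, 3, 9, 4, 5), (1, 7, 1, 9, 4), (0, 2, 3, 3, 13), (0, 3, 3, 9, 6),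
    (0, 1, 4, 7, 7), (0, 4, 7, 5, 3), (1, 3, 5, 4, 6)]),
  ((1, 5, 2, 13, 2), [1, 3, 5],
    [(0, 4, 11, 3, 3), (1, 2, 3, 5, 10), (1, 2, 5, 2, 11), (1, 3, 1, 14, 2), (2, 3, 9, 4, 3),
    (0, 7, 5, 1, 9), (1, 1, 12, 3, 5), (1, 5, 6, 5, 5), (1, 7, 1, 9, 4), (0, 3, 3, 9, 6),
    (0, 3, 5, 6, 7), (0, 5, 2, 7, 7), (1, 3, 9, 2, 6), (1, 7, 3, 4, 6), (0, 4, 7, 5, 3),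
    (1, 3, 5, 4, 6), (1, 5, 2, 5, 6)]),
  ((1, 5, 4, 10, 3), [0, 5],
    [(0, 4, 11, 3, 3), (1, 1, 6, 10, 3), (1, 1, 1, 4, 15)]),
  ((1, 5, 10, 1, 6), [4],
    [(1, 2, 3, 5, 10)]),
  ((1, 7, 3, 8, 4), [0, 1, 3],
    [(0, 7, 3, 2, 9), (2, 3, 9, 4, 3), (1, 3, 9, 4, 5), (1, 7, 1, 9, 4), (0, 3, 3, 9, 6),
    (0, 1, 4, 7, 7)]),
  ((1, 9, 2, 6, 5), [3],
    [(0, 3, 7, 3, 8), (0, 7, 3, 2, 9), (2, 3, 9, 4, 3), (0, 7, 5, 1, 9), (1, 3, 9, 4, 5),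
    (1, 7, 1, 9, 4), (0, 3, 3, 9, 6)]),
  ((1, 9, 4, 3, 6), [0, 1, 2],
    [(0, 3, 7, 3, 8), (0, 7, 5, 1, 9), (1, 7, 1, 9, 4), (0, 2, 3, 3, 13), (0, 3, 3, 9, 6),
    (1, 3, 9, 2, 6), (0, 1, 4, 7, 7)]),
  ((2, 9, 4, 5, 3), [0, 1],
    [(0, 7, 3, 2, 9), (0, 1, 4, 7, 7)])]

/-- The span of the basis monomials modulo `avgHit`. -/
def basisSpan : Submodule F32 (MvPolynomial (Fin 5) F32) :=
  avgHit ⊔ Submodule.span F32 (Set.range fun k => eigMon (basisExps k))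

theorem avgHit_le_basisSpan : avgHit ≤ basisSpan := le_sup_left

theorem eigMon_basisExps_mem (k : Fin 6) : eigMon (basisExps k) ∈ basisSpan :=
  le_sup_right (a := avgHit) (Submodule.subset_span ⟨k, rfl⟩)

theorem reduce_relations : (relations.all fun r =>
    (reduce (r.1 :: (r.2.1.map basisExps ++ r.2.2.flatMap hitTerms))).isEmpty) = true := by
  decide +kernel

theorem eigMon_mem_of_relation {r : Exps × List (Fin 6) × List Exps} (hr : r ∈ relations) :
    eigMon r.1 ∈ basisSpan := by
  have h0 := List.all_eq_true.mp reduce_relations r hr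
  rw [List.isEmpty_iff] at h0
  have h1 := evalSum_reduce_sub_mem (r.1 :: (r.2.1.map basisExps ++ r.2.2.flatMap hitTerms))
  have h2 : ∀ l : List (Fin 6), evalSum (l.map basisExps) ∈ basisSpan := fun l =>
    list_sum_mem (by simpa using fun k _ => eigMon_basisExps_mem k)
  have h3 : ∀ l : List Exps, evalSum (l.flatMap hitTerms) ∈ basisSpan := fun l => by
    induction l with
    | nil => simp [evalSum]
    | cons t l ih =>
      rw [List.flatMap_cons, evalSum, List.map_append, List.sum_append]
      exact add_mem (avgHit_le_basisSpan (evalSum_hitTerms_mem t)) ih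
  have h4 : evalSum (r.1 :: (r.2.1.map basisExps ++ r.2.2.flatMap hitTerms)) =
      eigMon r.1 + (evalSum (r.2.1.map basisExps) + evalSum (r.2.2.flatMap hitTerms)) := by
    simp [evalSum]
  rw [h0, h4, show evalSum [] = 0 from rfl, zero_sub] at h1
  have h5 := avgHit_le_basisSpan (neg_mem h1)
  rw [neg_neg] at h5
  exact (Submodule.add_mem_iff_left _ (add_mem (h2 _) (h3 _))).mp h5

/-- Whether the representative of the rotation class of a tuple is a basis tuple or occurs in a
relation. -/
def Exps.covered (t : Exps) : Bool :=
  (List.ofFn basisExps).elem t.canon || (relations.map Prod.fst).elem t.canon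

theorem eigMon_mem_of_covered {t : Exps} (ht : t.covered = true) : eigMon t ∈ basisSpan := by
  have h1 : eigMon t.canon ∈ basisSpan := by
    simp only [Exps.covered, Bool.or_eq_true, List.elem_eq_mem, decide_eq_true_eq,
      List.mem_ofFn, List.mem_map] at ht
    rcases ht with ⟨k, hk⟩ | ⟨r, hr, hrt⟩
    · rw [← hk]; exact eigMon_basisExps_mem k
    · rw [← hrt]; exact eigMon_mem_of_relation hr
  have h2 := avgHit_le_basisSpan (eigMon_canon_sub_mem t)
  simpa using sub_mem h1 h2

/-- Whether a tuple satisfies the claim of `covered_of_hasWt`. -/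
def Exps.test (t : Exps) : Bool :=
  bif t.wt 0 == 3 then bif t.wt 1 == 2 then bif t.wt 2 == 2 then bif t.char % 31 == 0 then
    t.covered else true else true else true else true

theorem covered_of_hasWt {t : Exps} (hd : t.deg = 23) (hc : t.char % 31 = 0)
    (hw : hasWt (toVec t) [3, 2, 2, 1]) : t.covered = true := by
  have key : ((List.range 24).all fun a => (List.range (24 - a)).all fun b =>
      (List.range (24 - (a + b))).all fun c => (List.range (24 - (a + b + c))).all fun d =>
        Exps.test (a, b, c, d, 23 - (a + b + c + d))) = true := by
    decide +kernel
  simp only [List.all_eq_true, List.mem_range] at key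
  obtain ⟨a, b, c, d, e⟩ := t
  have hw' := fun i => (wt_toVec _ i).symm.trans (hw i)
  simp only [Exps.deg] at hd
  obtain rfl : e = 23 - (a + b + c + d) := by omega
  have h := key a (by omega) b (by omega) c (by omega) d (by omega)
  rw [Exps.test, hw' 0, hw' 1, hw' 2, hc] at h
  exact h

theorem singerSum_mem_basisSpan {f : P5} (hf : f ∈ PLe 23 [3, 2, 2, 1]) :
    singerSum (map (algebraMap (ZMod 2) F32) f) ∈ basisSpan := by
  refine Submodule.span_le.mpr ?_ (singerSum_mem_span (mem_span_eigHom hf))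
  rintro _ ⟨t, rfl, hd, hc, hw | hw⟩
  · exact avgHit_le_basisSpan (hitMinusExt_le_avgHit (eigMon_mem_of_wtLt hd hw))
  · exact eigMon_mem_of_covered (covered_of_hasWt hd hc hw)

end Reduction

section Detection

open F32

/-- The substitution `x_j ↦ x_(σ⁻¹ j)`, as an element of `GL_5(F_2)`. -/
def permGL (σ : Fin 5 → Fin 5) (hσ : Function.Injective σ) :
    Matrix.GeneralLinearGroup (Fin 5) (ZMod 2) :=
  have h : Matrix.of (fun i j => if j = σ i then (1 : ZMod 2) else 0) *
      Matrix.of (fun i j => if i = σ j then 1 else 0) = 1 := by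
    ext i j
    simp [Matrix.mul_apply, Matrix.one_apply, hσ.eq_iff, eq_comm]
  { val := Matrix.of fun i j => if i = σ j then 1 else 0
    inv := Matrix.of fun i j => if j = σ i then 1 else 0
    val_inv := mul_eq_one_comm.mp h
    inv_val := h }

theorem actExt_permGL (σ : Fin 5 → Fin 5) (hσ : Function.Injective σ) (i : Fin 5) :
    actExt F32 (permGL σ hσ) (eig i) = linForm fun j => eigCoeff i (σ j) := by
  rw [eig, algHom_linForm _ _ (actExt_X _)]
  congr 1
  ext j
  simp [permGL]

/-- The product of eigenforms whose indices are given by binary digit. -/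
def levelMon (ι : Fin 8 → Fin 5) : MvPolynomial (Fin 5) F32 :=
  eig (ι 0) * eig (ι 1) * eig (ι 2) *
    (eig (ι 3) * eig (ι 4) * (eig (ι 5) * eig (ι 6) * eig (ι 7) ^ 2) ^ 2) ^ 2

theorem frobSum_levelMon (ι : Fin 8 → Fin 5) :
    frobSum (levelMon ι) = ∑ r : Fin 5, levelMon fun m => ι m + r := by
  have h1 : ∀ ι, actExt F32 frob (levelMon ι) = levelMon fun m => ι m + 1 := fun ι => by
    simp only [levelMon, map_mul, map_pow, actExt_frob]
  simp only [frobSum, powSum, LinearMap.add_apply, Finset.sum_range_succ, Finset.sum_range_zero,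
    pow_succ', pow_zero, Module.End.mul_apply, Module.End.one_apply, AlgHom.toLinearMap_apply,
    h1, zero_add, Fin.sum_univ_five, add_zero, add_assoc, Fin.reduceAdd]

/-- The indices of the eigenforms in the basis monomials, by binary digit. -/
def basisLevels : Fin 6 → Fin 8 → Fin 5 := ![
  ![1, 3, 4, 3, 4, 2, 3, 3], ![1, 3, 4, 3, 4, 2, 4, 2], ![2, 3, 4, 1, 2, 2, 4, 4],
  ![1, 2, 3, 1, 2, 3, 4, 3], ![1, 2, 4, 1, 3, 2, 4, 3], ![2, 3, 4, 2, 3, 1, 3, 2]]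

theorem eigMon_basisExps (k : Fin 6) : eigMon (basisExps k) = levelMon (basisLevels k) := by
  fin_cases k <;> simp [eigMon, basisExps, levelMon, basisLevels] <;> ring

/-- The coefficient of the spike in a permutation of an averaged basis monomial. -/
def spikeRow (σ : Fin 5 → Fin 5) (k : Fin 6) : F32 :=
  ∑ r : Fin 5, spikeVal (fun i j => eigCoeff i (σ j)) (basisLevels k 0 + r) (basisLevels k 1 + r)
    (basisLevels k 2 + r) (basisLevels k 3 + r) (basisLevels k 4 + r) (basisLevels k 5 + r)
    (basisLevels k 6 + r) (basisLevels k 7 + r)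

theorem coeff_spike_permGL (σ : Fin 5 → Fin 5) (hσ : Function.Injective σ) (k : Fin 6) :
    coeff spike (actExt F32 (permGL σ hσ) (frobSum (eigMon (basisExps k)))) = spikeRow σ k := by
  have h : ∀ ι, coeff spike (actExt F32 (permGL σ hσ) (levelMon ι)) =
      spikeVal (fun i j => eigCoeff i (σ j)) (ι 0) (ι 1) (ι 2) (ι 3) (ι 4) (ι 5) (ι 6) (ι 7) := by
    intro ι
    rw [← coeff_spike_prod]
    simp only [levelMon, map_mul, map_pow, actExt_permGL]
  rw [eigMon_basisExps, frobSum_levelMon, map_sum, coeff_sum, spikeRow]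
  simp only [h]

theorem exists_sub_sum_mem {p : MvPolynomial (Fin 5) F32} (hp : p ∈ basisSpan) :
    ∃ c : Fin 6 → F32,
      frobSum p - ∑ k, c k • frobSum (eigMon (basisExps k)) ∈ hitMinusExt F32 := by
  rw [basisSpan, Submodule.mem_sup] at hp
  obtain ⟨u, hu, v, hv, rfl⟩ := hp
  obtain ⟨c, rfl⟩ := (Submodule.mem_span_range_iff_exists_fun F32).mp hv
  rw [avgHit, Submodule.mem_comap] at hu
  refine ⟨c, ?_⟩
  rw [map_add, map_sum, Finset.sum_congr rfl fun k _ => map_smul frobSum (c k) _,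
    add_sub_cancel_right]
  exact hu

theorem mem_hitMinusExt_of_invariant {f : P5} (hf : f ∈ PLe 23 [3, 2, 2, 1])
    (hinv : ∀ g, actGL g f - f ∈ hitMinus) :
    map (algebraMap (ZMod 2) F32) f ∈ hitMinusExt F32 := by
  obtain ⟨p, hp⟩ : ∃ p, p = map (algebraMap (ZMod 2) F32) f := ⟨_, rfl⟩
  have hpinv : ∀ g, actExt F32 g p - p ∈ hitMinusExt F32 := fun g => by
    rw [hp, actExt_map, ← map_sub]
    exact map_mem_hitMinusExt (hinv g)
  obtain ⟨c, hc⟩ := exists_sub_sum_mem (singerSum_mem_basisSpan hf)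
  rw [← hp] at hc ⊢
  have hpc : p - ∑ k, c k • frobSum (eigMon (basisExps k)) ∈ hitMinusExt F32 := by
    rw [← sub_add_sub_cancel _ (frobSum (singerSum p))]
    exact add_mem (sub_average_mem hpinv) hc
  have key : ∀ σ (hσ : Function.Injective σ) {e : Fin 6 → F32}, spikeRow σ = e →
      coeff spike p = ∑ k, c k * e k := by
    rintro σ hσ _ rfl
    have h1 := coeff_spike_eq_zero_of_mem_ext (hpinv (permGL σ hσ))
    have h2 := coeff_spike_eq_zero_of_mem_ext (actExt_mem_hitMinusExt (permGL σ hσ) hpc)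
    simp only [map_sub, map_sum, map_smul, coeff_sub, coeff_sum, coeff_smul, coeff_spike_permGL,
      smul_eq_mul] at h1 h2
    rw [← sub_eq_zero.mp h1, sub_eq_zero.mp h2]
  have e1 := key ![0, 1, 4, 2, 3] (by decide) (e := ![1, 1, 0, 0, 0, 0]) (by decide +kernel)
  have e2 := key ![0, 1, 3, 2, 4] (by decide) (e := ![0, 1, 1, 0, 1, 0]) (by decide +kernel)
  have e3 := key ![0, 2, 1, 3, 4] (by decide) (e := ![1, 0, 1, 0, 1, 0]) (by decide +kernel)
  have e4 := key ![0, 3, 4, 1, 2] (by decide) (e := ![0, 0, 0, 1, 0, 0]) (by decide +kernel)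
  have e5 := key ![0, 1, 2, 3, 4] (by decide) (e := ![0, 0, 1, 1, 0, 0]) (by decide +kernel)
  have e6 := key ![4, 1, 0, 2, 3] (by decide) (e := ![0, 0, 0, 0, 0, 1]) (by decide +kernel)
  have e7 := key ![3, 1, 0, 2, 4] (by decide) (e := ![0, 1, 0, 0, 0, 1]) (by decide +kernel)
  simp only [Fin.sum_univ_six, Matrix.cons_val, mul_one, mul_zero, add_zero, zero_add]
    at e1 e2 e3 e4 e5 e6 e7
  have two : (2 : F32) = 0 := CharTwo.two_eq_zero
  have hκ : coeff spike p = 0 := by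
    linear_combination e1 + e2 + e3 + (c 0 + c 1 + c 2 + c 4 - coeff spike p) * two
  rw [hκ] at e1 e2 e3 e4 e5 e6 e7
  have hc3 : c 3 = 0 := e4.symm
  have hc5 : c 5 = 0 := e6.symm
  have hc1 : c 1 = 0 := by rw [hc5, add_zero] at e7; exact e7.symm
  have hc2 : c 2 = 0 := by rw [hc3, add_zero] at e5; exact e5.symm
  have hc0 : c 0 = 0 := by rw [hc1, add_zero] at e1; exact e1.symm
  have hc4 : c 4 = 0 := by rw [hc1, hc2, zero_add, zero_add] at e2; exact e2.symm
  simpa [Fin.sum_univ_six, hc0, hc1, hc2, hc3, hc4, hc5] using hpc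

end Detection

/-- The GL_5-invariants of QP_5((3, 2, 2, 1)) in degree 23 vanish. -/
theorem stmt17 (f : P5) (hf : f ∈ PLe 23 [3, 2, 2, 1])
    (hinv : ∀ g : Matrix.GeneralLinearGroup (Fin 5) (ZMod 2),
      ∃ h p : P5, IsHit 23 h ∧ p ∈ PMinus 23 [3, 2, 2, 1] ∧ actGL g f - f = h + p) :
    ∃ h p : P5, IsHit 23 h ∧ p ∈ PMinus 23 [3, 2, 2, 1] ∧ f = h + p := by
  exact mem_hitMinus_of_map F32.lam F32.lam_one (mem_hitMinusExt_of_invariant hf hinv)
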